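/- arXiv:1908.10675 — 3 statements merged into one kernel-verified Lean document; each statement's English description precedes it below -/
import Mathlib

section
/- Let d1, d2 be even positive integers and d3 an odd positive integer with gcd(d1, d2) = 2. Then for generic F = (f1, f2, f3) ∈ H(d1, d2, d3), the set {p ∈ ℂ³ : f3(p) = 0 and J(F)(p) = 0} is contained in a finite union of one-dimensional complex linear subspaces of ℂ³; that is, C(F) ∩ V(f3) consists of at most finitely many rays through the origin. -/
open MvPolynomial

/-- Index of coefficients of a triple of homogeneous polynomials of degrees `d 0, d 1, d 2`:
the coefficient space of `H(d₁,d₂,d₃)`. -/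
def CoeffIdx (d : Fin 3 → ℕ) : Type :=
  Σ i : Fin 3, { m : Fin 3 →₀ ℕ // (m.sum fun _ e => e) = d i }

/-- The coefficient tuple of a triple of polynomials, as a point of the coefficient space. -/
noncomputable def coeffsOf (d : Fin 3 → ℕ) (F : Fin 3 → MvPolynomial (Fin 3) ℂ) :
    CoeffIdx d → ℂ :=
  fun x => MvPolynomial.coeff x.2.1 (F x.1)

/-- The Jacobian matrix of a polynomial map `F : ℂ³ → ℂ³`. -/
noncomputable def jacMat (F : Fin 3 → MvPolynomial (Fin 3) ℂ) :
    Matrix (Fin 3) (Fin 3) (MvPolynomial (Fin 3) ℂ) :=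
  Matrix.of fun i j => MvPolynomial.pderiv j (F i)

/-- The Jacobian determinant `J(F)`. -/
noncomputable def jac (F : Fin 3 → MvPolynomial (Fin 3) ℂ) : MvPolynomial (Fin 3) ℂ :=
  (jacMat F).det

/-- The restriction of `f` to the affine chart `(1, y, z)`, as a polynomial in `z` over `R[y]`. -/
noncomputable def affineChart (R : Type*) [CommRing R] :
    MvPolynomial (Fin 3) R →+* Polynomial (Polynomial R) :=
  eval₂Hom (Polynomial.C.comp Polynomial.C) ![1, Polynomial.C Polynomial.X, Polynomial.X]

lemma affineChart_map {R S : Type*} [CommRing R] [CommRing S] (φ : R →+* S)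
    (f : MvPolynomial (Fin 3) R) :
    affineChart S (map φ f) = (affineChart R f).map (Polynomial.mapRingHom φ) := by
  rw [← Polynomial.coe_mapRingHom, ← RingHom.comp_apply, ← RingHom.comp_apply]
  congr 1
  refine ringHom_ext (fun r => ?_) fun i => ?_
  · simp [affineChart]
  · fin_cases i <;> simp [affineChart]

lemma affineChart_map_eval {R : Type*} [CommRing R] (f : MvPolynomial (Fin 3) R) (y : R) :
    (affineChart R f).map (Polynomial.evalRingHom y) =
      eval₂Hom Polynomial.C ![Polynomial.C 1, Polynomial.C y, Polynomial.X] f := by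
  rw [← Polynomial.coe_mapRingHom, ← RingHom.comp_apply]
  congr 1
  refine ringHom_ext (fun r => ?_) fun i => ?_
  · simp [affineChart]
  · fin_cases i <;> simp [affineChart]

lemma eval_line {R : Type*} [CommRing R] (f : MvPolynomial (Fin 3) R) (a b z : R) :
    (eval₂Hom Polynomial.C ![Polynomial.C a, Polynomial.C b, Polynomial.X] f).eval z =
      eval ![a, b, z] f := by
  rw [← Polynomial.coe_evalRingHom, ← RingHom.comp_apply]
  congr 1
  refine ringHom_ext (fun r => ?_) fun i => ?_
  · simp
  · fin_cases i <;> simp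

lemma natDegree_line_le {R : Type*} [CommRing R] {f : MvPolynomial (Fin 3) R} {e : ℕ}
    (hf : f.IsHomogeneous e) (p q : R) :
    (eval₂Hom Polynomial.C ![Polynomial.C p, Polynomial.C q, Polynomial.X] f).natDegree ≤ e := by
  rw [coe_eval₂Hom, eval₂_eq']
  refine Polynomial.natDegree_sum_le_of_forall_le _ _ fun m hm => ?_
  have hm' : m.degree = e := by
    by_contra h
    exact mem_support_iff.1 hm (hf.coeff_eq_zero h)
  have h2 : m 2 ≤ e := hm' ▸ Finsupp.le_degree 2 m
  simp only [Fin.prod_univ_three, Matrix.cons_val, ← map_pow, ← map_mul, ← mul_assoc]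
  exact (Polynomial.natDegree_C_mul_X_pow_le _ _).trans h2

lemma coeff_line {R : Type*} [CommRing R] {f : MvPolynomial (Fin 3) R} {e : ℕ}
    (hf : f.IsHomogeneous e) (p q : R) :
    (eval₂Hom Polynomial.C ![Polynomial.C p, Polynomial.C q, Polynomial.X] f).coeff e =
      coeff (Finsupp.single 2 e) f := by
  rw [coe_eval₂Hom, eval₂_eq', Polynomial.finsetSum_coeff]
  simp only [Fin.prod_univ_three, Matrix.cons_val, ← map_pow, ← map_mul, ← mul_assoc,
    Polynomial.coeff_C_mul_X_pow]
  rw [Finset.sum_eq_single (Finsupp.single 2 e)]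
  · simp
  · intro m hm hne
    rw [if_neg]
    intro he
    have hm' : m.degree = e := by
      by_contra h
      exact mem_support_iff.1 hm (hf.coeff_eq_zero h)
    rw [Finsupp.degree_eq_sum, Fin.sum_univ_three] at hm'
    apply hne
    ext i
    fin_cases i <;> simp <;> omega
  · intro h
    simp [notMem_support_iff.1 h]

lemma finite_zeros_line {K : Type*} [Field K] {f : MvPolynomial (Fin 3) K} {e : ℕ}
    (hf : f.IsHomogeneous e) (hc : coeff (Finsupp.single 2 e) f ≠ 0) (a b : K) :
    {z : K | eval ![a, b, z] f = 0}.Finite := by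
  set P := eval₂Hom Polynomial.C ![Polynomial.C a, Polynomial.C b, Polynomial.X] f with hP
  have h0 : P ≠ 0 := by
    intro h
    rw [← coeff_line hf a b, ← hP, h] at hc
    simp at hc
  refine (Polynomial.finite_setOfPred_isRoot h0).subset fun z hz => ?_
  rw [Set.mem_ofPred_eq, Polynomial.IsRoot, hP, eval_line]
  exact hz

lemma eval_smul_of_isHomogeneous {K : Type*} [Field K] {f : MvPolynomial (Fin 3) K} {e : ℕ}
    (hf : f.IsHomogeneous e) (c : K) (p : Fin 3 → K) :
    eval (c • p) f = c ^ e * eval p f := by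
  rw [eval_eq', eval_eq', Finset.mul_sum]
  refine Finset.sum_congr rfl fun m hm => ?_
  have hm' : m.degree = e := by
    by_contra h
    exact mem_support_iff.1 hm (hf.coeff_eq_zero h)
  rw [Finsupp.degree_eq_sum, Fin.sum_univ_three] at hm'
  simp only [Fin.prod_univ_three, Pi.smul_apply, smul_eq_mul, mul_pow, ← hm', pow_add]
  ring

/-- Two ternary forms with nonvanishing dehomogenized resultant have only finitely many common
zero rays. -/
lemma exists_finite_rays {K : Type*} [Field K] {f g : MvPolynomial (Fin 3) K} {e k n : ℕ}
    (he : e ≠ 0) (hf : f.IsHomogeneous e) (hg : g.IsHomogeneous k)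
    (hc : coeff (Finsupp.single 2 e) f ≠ 0) (hn : (affineChart K g).natDegree ≤ n)
    (hr : (affineChart K f).resultant (affineChart K g) e n ≠ 0) :
    ∃ L : Set (Submodule K (Fin 3 → K)), L.Finite ∧
      (∀ W ∈ L, Module.finrank K W = 1) ∧
      {p : Fin 3 → K | eval p f = 0 ∧ eval p g = 0} ⊆ ⋃ W ∈ L, (W : Set (Fin 3 → K)) := by
  set r := (affineChart K f).resultant (affineChart K g) e n with hrdef
  have hroot : ∀ y z : K, eval ![1, y, z] f = 0 → eval ![1, y, z] g = 0 → r.IsRoot y := by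
    intro y z hfz hgz
    set P := (affineChart K f).map (Polynomial.evalRingHom y)
    set Q := (affineChart K g).map (Polynomial.evalRingHom y)
    have hP : P.natDegree ≤ e := by
      simp only [P, affineChart_map_eval]
      exact natDegree_line_le hf 1 y
    have hQ : Q.natDegree ≤ n := Polynomial.natDegree_map_le.trans hn
    obtain ⟨u, v, -, -, huv⟩ :=
      Polynomial.exists_mul_add_mul_eq_C_resultant P Q hP hQ (Or.inl he)
    have := congrArg (Polynomial.eval z) huv
    simp only [P, Q, Polynomial.resultant_map_map, Polynomial.eval_add, Polynomial.eval_mul,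
      Polynomial.eval_C, affineChart_map_eval, eval_line, hfz, hgz] at this
    simpa using this.symm
  let S : Set (Fin 3 → K) := (⋃ y ∈ {y | r.IsRoot y},
    (fun z => ![1, y, z]) '' {z | eval ![1, y, z] f = 0}) ∪
      ((fun z => ![0, 1, z]) '' {z | eval ![0, 1, z] f = 0} ∪ {![0, 0, 1]})
  have hS : S.Finite := by
    refine Set.Finite.union ?_ (Set.Finite.union ?_ (Set.finite_singleton _))
    · exact (Polynomial.finite_setOfPred_isRoot hr).biUnion fun y _ =>
        (finite_zeros_line hf hc 1 y).image _
    · exact (finite_zeros_line hf hc 0 1).image _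
  have hS0 : ∀ p ∈ S, p ≠ 0 := by
    rintro p (hp | ⟨z, -, rfl⟩ | rfl) h0
    · simp only [Set.mem_iUnion] at hp
      obtain ⟨y, -, z, -, rfl⟩ := hp
      simpa using congrFun h0 0
    · simpa using congrFun h0 1
    · simpa using congrFun h0 2
  refine ⟨(fun p => Submodule.span K {p}) '' S, hS.image _, ?_, ?_⟩
  · rintro _ ⟨p, hp, rfl⟩
    exact finrank_span_singleton (hS0 p hp)
  · rintro p ⟨hpf, hpg⟩
    have key : ∀ c : K, c ≠ 0 → c⁻¹ • p ∈ S →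
        p ∈ ⋃ W ∈ (fun p => Submodule.span K {p}) '' S, (W : Set (Fin 3 → K)) := by
      intro c hc0 hcS
      refine Set.mem_biUnion (Set.mem_image_of_mem _ hcS) ?_
      exact Submodule.mem_span_singleton.2 ⟨c, smul_inv_smul₀ hc0 p⟩
    by_cases h0 : p 0 = 0
    · by_cases h1 : p 1 = 0
      · refine Set.mem_biUnion (Set.mem_image_of_mem _ (Or.inr (Or.inr rfl))) ?_
        refine Submodule.mem_span_singleton.2 ⟨p 2, ?_⟩
        ext i
        fin_cases i <;> simp [h0, h1]
      · refine key (p 1) h1 (Or.inr (Or.inl ⟨(p 1)⁻¹ * p 2, ?_⟩))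
        have hp : (p 1)⁻¹ • p = ![0, 1, (p 1)⁻¹ * p 2] := by
          ext i
          fin_cases i <;> simp [h0, h1]
        refine ⟨?_, hp.symm⟩
        rw [Set.mem_ofPred_eq, ← hp, eval_smul_of_isHomogeneous hf, hpf, mul_zero]
    · have hp : (p 0)⁻¹ • p = ![1, (p 0)⁻¹ * p 1, (p 0)⁻¹ * p 2] := by
        ext i
        fin_cases i <;> simp [h0]
      have hf' : eval ![1, (p 0)⁻¹ * p 1, (p 0)⁻¹ * p 2] f = 0 := by
        rw [← hp, eval_smul_of_isHomogeneous hf, hpf, mul_zero]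
      have hg' : eval ![1, (p 0)⁻¹ * p 1, (p 0)⁻¹ * p 2] g = 0 := by
        rw [← hp, eval_smul_of_isHomogeneous hg, hpg, mul_zero]
      refine key (p 0) h0 (Or.inl ?_)
      exact Set.mem_biUnion (hroot _ _ hf' hg') ⟨_, hf', hp.symm⟩

/-- The Jacobian determinant over an arbitrary commutative ring. -/
noncomputable def jacobianDet {R : Type*} [CommRing R] (F : Fin 3 → MvPolynomial (Fin 3) R) :
    MvPolynomial (Fin 3) R :=
  (Matrix.of fun i j => pderiv j (F i)).det

lemma map_jacobianDet {R S : Type*} [CommRing R] [CommRing S] (φ : R →+* S)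
    (F : Fin 3 → MvPolynomial (Fin 3) R) :
    map φ (jacobianDet F) = jacobianDet fun i => map φ (F i) := by
  rw [jacobianDet, RingHom.map_det, jacobianDet]
  congr 1
  ext i j : 2
  simp [pderiv_map]

lemma isHomogeneous_jacobianDet {R : Type*} [CommRing R] {d : Fin 3 → ℕ}
    {F : Fin 3 → MvPolynomial (Fin 3) R} (hF : ∀ i, (F i).IsHomogeneous (d i)) :
    (jacobianDet F).IsHomogeneous (∑ i, (d i - 1)) := by
  rw [jacobianDet, Matrix.det_apply]
  refine IsHomogeneous.sum _ _ _ fun σ _ => ?_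
  have h : (∏ i, Matrix.of (fun i j => pderiv j (F i)) (σ i) i).IsHomogeneous
      (∑ i, (d (σ i) - 1)) := by
    refine IsHomogeneous.prod _ _ _ fun i _ => ?_
    exact (hF (σ i)).pderiv
  rw [Equiv.sum_comp σ fun i => d i - 1] at h
  rcases Int.units_eq_one_or (Equiv.Perm.sign σ) with hs | hs
  · simpa [hs] using h
  · simpa [hs] using h.neg

open Classical in
/-- The generic triple of forms of degrees `d`, whose coefficients are indeterminates. -/
noncomputable def genericTriple (d : Fin 3 → ℕ) (i : Fin 3) :
    MvPolynomial (Fin 3) (MvPolynomial (CoeffIdx d) ℂ) :=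
  ∑ m ∈ Finset.finsuppAntidiag Finset.univ (d i),
    if h : (m.sum fun _ e => e) = d i then monomial m (X (⟨i, m, h⟩ : CoeffIdx d)) else 0

lemma map_genericTriple {d : Fin 3 → ℕ} {F : Fin 3 → MvPolynomial (Fin 3) ℂ}
    (hF : ∀ i, (F i).IsHomogeneous (d i)) (i : Fin 3) :
    map (eval (coeffsOf d F)) (genericTriple d i) = F i := by
  classical
  have hsum : ∀ m : Fin 3 →₀ ℕ, m ∈ Finset.finsuppAntidiag Finset.univ (d i) ↔
      (m.sum fun _ e => e) = d i := fun m => by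
    rw [Finset.mem_finsuppAntidiag', and_iff_left (Finset.subset_univ _)]
  have hmap : map (eval (coeffsOf d F)) (genericTriple d i) =
      ∑ m ∈ Finset.finsuppAntidiag Finset.univ (d i), monomial m (coeff m (F i)) := by
    rw [genericTriple, map_sum]
    refine Finset.sum_congr rfl fun m hm => ?_
    rw [dif_pos ((hsum m).1 hm), map_monomial]
    exact congrArg (monomial m) (eval_X (f := coeffsOf d F) _)
  rw [hmap]
  ext m
  simp only [coeff_sum, coeff_monomial, Finset.sum_ite_eq']
  split_ifs with h
  · rfl
  · refine ((hF i).coeff_eq_zero fun hd => h ((hsum m).2 ?_)).symm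
    exact hd

/-- A triple whose Jacobian determinant does not vanish at the only zero of its third component
on the line `y = 0`. -/
noncomputable def witnessTriple (d : Fin 3 → ℕ) : Fin 3 → MvPolynomial (Fin 3) ℂ :=
  ![X 0 ^ d 0, X 0 ^ (d 1 - 1) * X 2, X 2 ^ d 2 + X 0 ^ (d 2 - 1) * X 1]

lemma isHomogeneous_witnessTriple {d : Fin 3 → ℕ} (hd : ∀ i, 0 < d i) (i : Fin 3) :
    (witnessTriple d i).IsHomogeneous (d i) := by
  have hmul (a : ℕ) (ha : 0 < a) (j : Fin 3) :
      (X 0 ^ (a - 1) * X j : MvPolynomial (Fin 3) ℂ).IsHomogeneous a := by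
    have := (isHomogeneous_X_pow (R := ℂ) (0 : Fin 3) (a - 1)).mul (isHomogeneous_X ℂ j)
    rwa [Nat.sub_add_cancel ha] at this
  fin_cases i
  · exact isHomogeneous_X_pow _ _
  · exact hmul _ (hd 1) 2
  · exact (isHomogeneous_X_pow _ _).add (hmul _ (hd 2) 1)

lemma eval_jacobianDet_witnessTriple {d : Fin 3 → ℕ} :
    eval ![1, 0, 0] (jacobianDet (witnessTriple d)) = -d 0 := by
  simp [jacobianDet, witnessTriple, Matrix.det_fin_three, pderiv_X, Derivation.leibniz]

/-- For `d₁, d₂` even, `d₃` odd, `gcd(d₁,d₂) = 2`, and generic `F ∈ H(d₁,d₂,d₃)`,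
the set `C(F) ∩ V(f₃)` is contained in a finite union of rays (one-dimensional
complex linear subspaces of `ℂ³`). -/
theorem generic_crit_inter_f3_finitely_many_rays
    (d : Fin 3 → ℕ) (hd : ∀ i, 0 < d i)
    (h1 : Even (d 0)) (h2 : Even (d 1)) (h3 : Odd (d 2))
    (hgcd : Nat.gcd (d 0) (d 1) = 2) :
    ∃ R : MvPolynomial (CoeffIdx d) ℂ, R ≠ 0 ∧
      ∀ F : Fin 3 → MvPolynomial (Fin 3) ℂ,
        (∀ i, (F i).IsHomogeneous (d i)) →
        MvPolynomial.eval (coeffsOf d F) R ≠ 0 →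
        ∃ L : Set (Submodule ℂ (Fin 3 → ℂ)), L.Finite ∧
          (∀ W ∈ L, Module.finrank ℂ W = 1) ∧
          {p : Fin 3 → ℂ |
              MvPolynomial.eval p (F 2) = 0 ∧ MvPolynomial.eval p (jac F) = 0} ⊆
            ⋃ W ∈ L, (W : Set (Fin 3 → ℂ)) := by
  set f := affineChart _ (genericTriple d 2)
  set g := affineChart _ (jacobianDet (genericTriple d))
  set n := g.natDegree
  let c : MvPolynomial (CoeffIdx d) ℂ := coeff (Finsupp.single 2 (d 2)) (genericTriple d 2)
  have hf : ∀ F : Fin 3 → MvPolynomial (Fin 3) ℂ, (∀ i, (F i).IsHomogeneous (d i)) →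
      affineChart ℂ (F 2) = f.map (Polynomial.mapRingHom (eval (coeffsOf d F))) := fun F hF => by
    rw [← affineChart_map, map_genericTriple hF]
  have hg : ∀ F : Fin 3 → MvPolynomial (Fin 3) ℂ, (∀ i, (F i).IsHomogeneous (d i)) →
      affineChart ℂ (jacobianDet F) =
        g.map (Polynomial.mapRingHom (eval (coeffsOf d F))) := fun F hF => by
    simp only [g, ← affineChart_map, map_jacobianDet, map_genericTriple hF]
  have hn : ∀ F : Fin 3 → MvPolynomial (Fin 3) ℂ, (∀ i, (F i).IsHomogeneous (d i)) →
      (affineChart ℂ (jacobianDet F)).natDegree ≤ n := fun F hF => by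
    rw [hg F hF]
    exact Polynomial.natDegree_map_le
  have hc : ∀ F : Fin 3 → MvPolynomial (Fin 3) ℂ, (∀ i, (F i).IsHomogeneous (d i)) →
      eval (coeffsOf d F) c = coeff (Finsupp.single 2 (d 2)) (F 2) := fun F hF => by
    rw [← coeff_map, map_genericTriple hF]
  have hr : ∀ F : Fin 3 → MvPolynomial (Fin 3) ℂ, (∀ i, (F i).IsHomogeneous (d i)) →
      eval (coeffsOf d F) ((f.resultant g (d 2) n).eval 0) =
        ((affineChart ℂ (F 2)).resultant (affineChart ℂ (jacobianDet F)) (d 2) n).eval 0 :=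
    fun F hF => by
      rw [hf F hF, hg F hF, Polynomial.resultant_map_map, Polynomial.coe_mapRingHom,
        Polynomial.eval_zero_map]
  refine ⟨c * (f.resultant g (d 2) n).eval 0, ?_, ?_⟩
  · intro h
    have hW := isHomogeneous_witnessTriple hd
    have h := congrArg (eval (coeffsOf d (witnessTriple d))) h
    rw [map_mul, hc _ hW, hr _ hW, map_zero, mul_eq_zero] at h
    rcases h with h | h
    · rw [← coeff_line (hW 2) 0 0] at h
      simp [witnessTriple] at h
    · rw [← Polynomial.coe_evalRingHom, ← Polynomial.resultant_map_map] at h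
      have hX : (affineChart ℂ (witnessTriple d 2)).map (Polynomial.evalRingHom 0) =
          Polynomial.X ^ d 2 := by
        rw [affineChart_map_eval]
        simp [witnessTriple]
      rw [hX, Polynomial.resultant_X_pow_left _ _ _
        (Polynomial.natDegree_map_le.trans (hn _ hW)), affineChart_map_eval,
        Polynomial.coeff_zero_eq_eval_zero, eval_line, eval_jacobianDet_witnessTriple] at h
      simpa [(hd 0).ne'] using eq_zero_of_pow_eq_zero h
  · intro F hF hR
    rw [map_mul, hc F hF, hr F hF] at hR
    refine exists_finite_rays (g := jacobianDet F) (hd 2).ne' (hF 2)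
      (isHomogeneous_jacobianDet hF) (left_ne_zero_of_mul hR) (hn F hF)
      fun h => right_ne_zero_of_mul hR ?_
    rw [h, Polynomial.eval_zero]
end

section
/- Let d1, d2, d3 be pairwise coprime positive integers. Then for generic F ∈ H(d1, d2, d3), F restricted to any ray contained in its critical set is injective: for every p ∈ ℂ³ with p ≠ 0 and J(F)(p) = 0, and every λ ∈ ℂ, if F(λp) = F(p) then λ = 1. -/
open MvPolynomial

namespace MvPolynomial

/-- A polynomial map from a linear subspace of an affine space, of smaller dimension than the
target, has its image in a hypersurface. -/
theorem exists_ne_zero_eval_eq_zero_of_card_lt {K : Type*} [Field K] {σ τ : Type*} [Fintype σ]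
    [Fintype τ] [DecidableEq τ] (Φ : σ → MvPolynomial τ K) (S : Finset τ)
    (h : Fintype.card τ < Fintype.card σ + S.card) :
    ∃ R : MvPolynomial σ K, R ≠ 0 ∧
      ∀ t : τ → K, (∀ s ∈ S, t s = 0) → eval (fun s => eval t (Φ s)) R = 0 := by
  classical
  let κ : MvPolynomial τ K →ₐ[K] MvPolynomial {s // s ∉ S} K :=
    aeval fun s => if hs : s ∉ S then X ⟨s, hs⟩ else 0
  have hdep : ¬ AlgebraicIndependent K fun s => κ (Φ s) := by
    intro hind
    have hle := hind.lift_cardinalMk_le_trdeg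
    rw [trdeg_of_isDomain] at hle
    simp only [Cardinal.mk_fintype, Cardinal.lift_natCast, Nat.cast_le] at hle
    rw [Fintype.card_subtype_compl, Fintype.card_coe] at hle
    have := S.card_le_univ
    omega
  rw [algebraicIndependent_iff] at hdep
  push Not at hdep
  obtain ⟨R, hR, hne⟩ := hdep
  refine ⟨R, hne, fun t ht => ?_⟩
  have hκ (f : MvPolynomial τ K) : eval (fun s : {s // s ∉ S} => t s) (κ f) = eval t f := by
    induction f using MvPolynomial.induction_on with
    | C a => simp [κ]
    | add f g hf hg => simp [hf, hg]
    | mul_X f s hf =>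
      rw [map_mul, map_mul, hf, map_mul]
      by_cases hs : s ∈ S <;> simp [κ, hs, ht]
  have := congrArg (eval fun s : {s // s ∉ S} => t s) hR
  rw [map_zero, aeval_def, eval₂_eq', map_sum] at this
  rw [eval_eq']
  simpa [hκ] using this

variable {σ K : Type*} [Field K]

theorem IsHomogeneous.eval_smul [Fintype σ] {f : MvPolynomial σ K} {n : ℕ}
    (hf : f.IsHomogeneous n) (c : K) (p : σ → K) : eval (c • p) f = c ^ n * eval p f := by
  rw [eval_eq, eval_eq, Finset.mul_sum]
  refine Finset.sum_congr rfl fun m hm => ?_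
  have hdeg : ∑ i ∈ m.support, m i = n := by
    by_contra hne
    exact (mem_support_iff.mp hm) (hf.coeff_eq_zero hne)
  simp only [Pi.smul_apply, smul_eq_mul, mul_pow, Finset.prod_mul_distrib,
    Finset.prod_pow_eq_pow_sum, hdeg]
  ring

theorem IsHomogeneous.eval_single [DecidableEq σ] [Fintype σ] {f : MvPolynomial σ K} {n : ℕ}
    (hf : f.IsHomogeneous n) (k : σ) :
    eval (Pi.single k 1) f = coeff (Finsupp.single k n) f := by
  rw [eval_eq', Finset.sum_eq_single (Finsupp.single k n)]
  · rw [Finset.prod_eq_one, mul_one]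
    intro i _
    by_cases h : i = k
    · subst h; simp
    · simp [h]
  · intro m hm hne
    have hdeg : m.degree = n := by
      by_contra h
      exact (mem_support_iff.mp hm) (hf.coeff_eq_zero h)
    obtain ⟨i, hik, hi⟩ : ∃ i, i ≠ k ∧ m i ≠ 0 := by
      by_contra! h
      have hm' : m = Finsupp.single k (m k) := by
        ext i
        by_cases hik : i = k
        · subst hik; simp
        · simp [hik, h i hik]
      rw [hm', Finsupp.degree_single] at hdeg
      exact hne (hdeg ▸ hm')
    rw [Finset.prod_eq_zero (Finset.mem_univ i), mul_zero]
    simp [hik, hi]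
  · intro h
    rw [notMem_support_iff.mp h, zero_mul]

/-- The linear substitution `X x ↦ X x + v x * X k`. -/
noncomputable def shear {A : Type*} [CommRing A] (k : σ) (v : σ → A) :
    MvPolynomial σ A →ₐ[A] MvPolynomial σ A :=
  aeval fun x => X x + C (v x) * X k

section Shear

variable {A : Type*} [CommRing A] (k : σ) (v : σ → A)

theorem shear_neg_shear (hv : v k = 0) (f : MvPolynomial σ A) :
    shear k (-v) (shear k v f) = f := by
  have : (shear k (-v)).comp (shear k v) = AlgHom.id A _ := by
    ext x
    simp [shear, hv, ← algebraMap_eq]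
  exact DFunLike.congr_fun this f

theorem map_shear {B : Type*} [CommRing B] (g : A →+* B) (f : MvPolynomial σ A) :
    map g (shear k v f) = shear k (g ∘ v) (map g f) := by
  induction f using MvPolynomial.induction_on with
  | C a => simp [shear, ← algebraMap_eq]
  | add f g hf hg => simp [hf, hg]
  | mul_X f s hf => simp only [map_mul, hf]; simp [shear]

theorem IsHomogeneous.shear {f : MvPolynomial σ A} {n : ℕ} (hf : f.IsHomogeneous n) :
    (shear k v f).IsHomogeneous n := by
  have := hf.aeval (fun x => X x + C (v x) * X k) (n := 1) fun x =>
    (isHomogeneous_X A x).add (by simpa using (isHomogeneous_C σ (v x)).mul (isHomogeneous_X A k))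
  simpa [MvPolynomial.shear] using this

theorem pderiv_shear {x : σ} (hx : x ≠ k) (f : MvPolynomial σ A) :
    pderiv x (shear k v f) = shear k v (pderiv x f) := by
  classical
  induction f using MvPolynomial.induction_on with
  | C a => simp [shear, ← algebraMap_eq]
  | add f g hf hg => simp [hf, hg]
  | mul_X f s hf =>
    simp only [map_mul, Derivation.leibniz, hf, map_add, smul_eq_mul]
    by_cases hs : s = x
    · subst hs; simp [shear, pderiv_X, hx.symm]
    · simp [shear, pderiv_X, hx.symm, hs]

theorem eval_shear (p : σ → A) (f : MvPolynomial σ A) :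
    eval p (shear k v f) = eval (p + p k • v) f := by
  induction f using MvPolynomial.induction_on with
  | C a => simp [shear, ← algebraMap_eq]
  | add f g hf hg => simp [hf, hg]
  | mul_X f s hf => simp only [map_mul, hf]; simp [shear, mul_comm]

end Shear

theorem IsHomogeneous.eval_pderiv_single [DecidableEq σ] [Fintype σ] {f : MvPolynomial σ K} {n : ℕ}
    (hf : f.IsHomogeneous n) {k x : σ} (hx : x ≠ k) :
    eval (Pi.single k 1) (pderiv x f) =
      coeff (Finsupp.single k (n - 1) + Finsupp.single x 1) f := by
  rw [hf.pderiv.eval_single, coeff_pderiv]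
  simp [hx]

end MvPolynomial

variable {d : Fin 3 → ℕ}

instance CoeffIdx.finite (d : Fin 3 → ℕ) : Finite (CoeffIdx d) := by
  have (i : Fin 3) : Finite { m : Fin 3 →₀ ℕ // (m.sum fun _ e => e) = d i } :=
    (Finsupp.finite_of_degree_eq (σ := Fin 3) (d i)).to_subtype
  unfold CoeffIdx
  infer_instance

noncomputable instance CoeffIdx.fintype (d : Fin 3 → ℕ) : Fintype (CoeffIdx d) :=
  Fintype.ofFinite _

/-- The index of the coefficient of `X k ^ (d i - 1) * X x` in the `i`-th polynomial. -/
noncomputable def CoeffIdx.nearPower (hd : ∀ i, 0 < d i) (k i x : Fin 3) : CoeffIdx d :=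
  ⟨i, Finsupp.single k (d i - 1) + Finsupp.single x 1, by
    change Finsupp.degree _ = _
    have := hd i
    simp only [map_add, Finsupp.degree_single]
    omega⟩

theorem CoeffIdx.nearPower_inj (hd : ∀ i, 0 < d i) (k : Fin 3) {i j x y : Fin 3} :
    nearPower hd k i x = nearPower hd k j y ↔ i = j ∧ x = y := by
  refine ⟨fun h => ?_, by rintro ⟨rfl, rfl⟩; rfl⟩
  have hij : i = j := congrArg Sigma.fst h
  subst hij
  have h2 := congrArg Subtype.val (eq_of_heq (Sigma.mk.inj h).2)
  exact ⟨rfl, Finsupp.single_left_injective one_ne_zero (add_left_cancel h2)⟩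

/-- The coefficients of a sheared triple are polynomial in the shear and in the coefficients. -/
theorem exists_polynomial_coeffsOf_shear (d : Fin 3 → ℕ) (k : Fin 3) :
    ∃ Φ : CoeffIdx d → MvPolynomial (Fin 3 ⊕ CoeffIdx d) ℂ,
      ∀ (G : Fin 3 → MvPolynomial (Fin 3) ℂ) (v : Fin 3 → ℂ), (∀ i, (G i).IsHomogeneous (d i)) →
        ∀ s, eval (Sum.elim v (coeffsOf d G)) (Φ s) =
          coeffsOf d (fun i => shear k (-v) (G i)) s := by
  have (i : Fin 3) : Fintype { m : Fin 3 →₀ ℕ // (m.sum fun _ e => e) = d i } :=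
    @Fintype.ofFinite _ (Finsupp.finite_of_degree_eq (σ := Fin 3) (d i)).to_subtype
  let U (i : Fin 3) : MvPolynomial (Fin 3) (MvPolynomial (Fin 3 ⊕ CoeffIdx d) ℂ) :=
    ∑ m : { m : Fin 3 →₀ ℕ // (m.sum fun _ e => e) = d i },
      monomial m.1 (X (Sum.inr (⟨i, m⟩ : CoeffIdx d)))
  refine ⟨fun s => coeff s.2.1 (shear k (fun x => -X (Sum.inl x)) (U s.1)), fun G v hG s => ?_⟩
  have hU (i : Fin 3) : map (eval (Sum.elim v (coeffsOf d G))) (U i) = G i := by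
    ext m
    simp only [U, map_sum, map_monomial, eval_X, coeff_sum, coeff_monomial]
    by_cases hm : (m.sum fun _ e => e) = d i
    · rw [Finset.sum_eq_single ⟨m, hm⟩ (by simp +contextual [Subtype.ext_iff]) (by simp), if_pos rfl]
      rfl
    · rw [(hG i).coeff_eq_zero hm]
      exact Finset.sum_eq_zero fun m' _ => if_neg fun h : m'.1 = m => hm (h ▸ m'.2)
  rw [← coeff_map, map_shear, hU]
  congr 3
  ext x
  simp

theorem exists_ne_zero_eval_coeffsOf_eq_zero (k : Fin 3) (S : Finset (CoeffIdx d))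
    (hS : 3 ≤ S.card) (ψ : CoeffIdx d → MvPolynomial (CoeffIdx d) ℂ) :
    ∃ R : MvPolynomial (CoeffIdx d) ℂ, R ≠ 0 ∧
      ∀ F : Fin 3 → MvPolynomial (Fin 3) ℂ, (∀ i, (F i).IsHomogeneous (d i)) →
        ∀ v : Fin 3 → ℂ, v k = 0 → ∀ w : CoeffIdx d → ℂ, (∀ s ∈ S, w s = 0) →
          (∀ s, eval w (ψ s) = coeffsOf d (fun i => shear k v (F i)) s) →
          eval (coeffsOf d F) R = 0 := by
  classical
  obtain ⟨Φ, hΦ⟩ := exists_polynomial_coeffsOf_shear d k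
  obtain ⟨R, hR, h⟩ := exists_ne_zero_eval_eq_zero_of_card_lt
    (fun s => bind₁ (Sum.elim (fun x => X (Sum.inl x)) fun s => rename Sum.inr (ψ s)) (Φ s))
    (({k} : Finset (Fin 3)).disjSum S) (by simp; omega)
  refine ⟨R, hR, fun F hF v hv w hw hψ => ?_⟩
  have key := h (Sum.elim v w) (by
    rintro (x | s) hs
    · simp only [Finset.inl_mem_disjSum, Finset.mem_singleton] at hs
      simp [hs, hv]
    · simpa using hw s (by simpa using hs))
  rw [← key]
  congr 2
  funext s
  have hF' : coeffsOf d F = coeffsOf d fun i => shear k (-v) (shear k v (F i)) := by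
    simp [shear_neg_shear, hv]
  rw [hF', ← hΦ (fun i => shear k v (F i)) v fun i => (hF i).shear k v]
  simp only [eval, eval₂Hom_bind₁]
  congr 1
  ext x
  · simp
  · rcases x with x | x
    · simp
    · simpa [eval_rename, Sum.elim_comp_inr] using (hψ x).symm

section Point

variable (hd : ∀ i, 0 < d i) {F : Fin 3 → MvPolynomial (Fin 3) ℂ} {k : Fin 3} {q : Fin 3 → ℂ}

theorem coeffsOf_shear_nearPower_self (hF : ∀ i, (F i).IsHomogeneous (d i))
    (i : Fin 3) :
    coeffsOf d (fun i => shear k (q - Pi.single k 1) (F i)) (.nearPower hd k i k) =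
      eval q (F i) := by
  have h := ((hF i).shear k (q - Pi.single k 1)).eval_single k
  rw [eval_shear] at h
  simp only [Pi.single_eq_same, one_smul, add_sub_cancel] at h
  rw [h]
  change coeff (Finsupp.single k (d i - 1) + Finsupp.single k 1) _ = _
  rw [← Finsupp.single_add, Nat.sub_add_cancel (hd i)]
  rfl

theorem coeffsOf_shear_nearPower_of_ne (hF : ∀ i, (F i).IsHomogeneous (d i)) (i : Fin 3)
    {x : Fin 3} (hx : x ≠ k) :
    coeffsOf d (fun i => shear k (q - Pi.single k 1) (F i)) (.nearPower hd k i x) =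
      eval q (pderiv x (F i)) := by
  have h := ((hF i).shear k (q - Pi.single k 1)).eval_pderiv_single hx
  rw [pderiv_shear k _ hx, eval_shear] at h
  simp only [Pi.single_eq_same, one_smul, add_sub_cancel] at h
  exact h.symm

end Point

theorem exists_ne_zero_of_common_zero (hd : ∀ i, 0 < d i) (k : Fin 3) :
    ∃ R : MvPolynomial (CoeffIdx d) ℂ, R ≠ 0 ∧
      ∀ F : Fin 3 → MvPolynomial (Fin 3) ℂ, (∀ i, (F i).IsHomogeneous (d i)) →
        ∀ q : Fin 3 → ℂ, q k = 1 → (∀ i, eval q (F i) = 0) → eval (coeffsOf d F) R = 0 := by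
  classical
  obtain ⟨R, hR, h⟩ := exists_ne_zero_eval_coeffsOf_eq_zero k
    (Finset.univ.image fun i => CoeffIdx.nearPower hd k i k)
    (by
      rw [Finset.card_image_of_injective _ fun i j hij =>
        ((CoeffIdx.nearPower_inj hd k).mp hij).1]
      simp)
    X
  refine ⟨R, hR, fun F hF q hq h0 => h F hF (q - Pi.single k 1) (by simp [hq]) _ ?_
    fun s => eval_X s⟩
  simp only [Finset.mem_image, Finset.mem_univ, true_and, forall_exists_index,
    forall_apply_eq_imp_iff]
  intro i
  rw [coeffsOf_shear_nearPower_self hd hF, h0]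

theorem exists_ne_zero_of_tangent (hd : ∀ i, 0 < d i) {k a b i j : Fin 3} (ha : a ≠ k)
    (hb : b ≠ k) (hab : a ≠ b) (hij : i ≠ j) :
    ∃ R : MvPolynomial (CoeffIdx d) ℂ, R ≠ 0 ∧
      ∀ F : Fin 3 → MvPolynomial (Fin 3) ℂ, (∀ i, (F i).IsHomogeneous (d i)) →
        ∀ q : Fin 3 → ℂ, q k = 1 → eval q (F i) = 0 → eval q (F j) = 0 → ∀ t : ℂ,
          eval q (pderiv a (F j)) = t * eval q (pderiv a (F i)) →
          eval q (pderiv b (F j)) = t * eval q (pderiv b (F i)) →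
          eval (coeffsOf d F) R = 0 := by
  classical
  let c (i x : Fin 3) : CoeffIdx d := .nearPower hd k i x
  have hc {i j x y : Fin 3} : c i x = c j y ↔ i = j ∧ x = y := CoeffIdx.nearPower_inj hd k
  obtain ⟨R, hR, h⟩ := exists_ne_zero_eval_coeffsOf_eq_zero k {c i k, c j k, c j b}
    (by rw [Finset.card_eq_three.mpr ⟨_, _, _, ?_, ?_, ?_, rfl⟩] <;> simp [hc, hij, hb.symm])
    (fun s => if s = c j a then X (c j a) * X (c i a) else
      if s = c j b then X (c j a) * X (c i b) else X s)
  refine ⟨R, hR, fun F hF q hq hi hj t hta htb => ?_⟩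
  set u := coeffsOf d fun i => shear k (q - Pi.single k 1) (F i) with hu
  have huk (i : Fin 3) : u (c i k) = eval q (F i) := coeffsOf_shear_nearPower_self hd hF i
  have hux (i : Fin 3) {x : Fin 3} (hx : x ≠ k) : u (c i x) = eval q (pderiv x (F i)) :=
    coeffsOf_shear_nearPower_of_ne hd hF i hx
  refine h F hF (q - Pi.single k 1) (by simp [hq])
    (Function.update (Function.update u (c j b) 0) (c j a) t) ?_ fun s => ?_
  · simp only [Finset.mem_insert, Finset.mem_singleton]
    rintro s (rfl | rfl | rfl)
    · simp [hc, hij, huk, hi]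
    · simp [hc, ha.symm, hb.symm, huk, hj]
    · simp [hc, hab.symm]
  · rw [← hu]
    by_cases hsa : s = c j a
    · subst hsa
      simp [hc, hij, hux _ ha, hta]
    by_cases hsb : s = c j b
    · subst hsb
      simp [hc, hij, hab.symm, hux _ hb, htb]
    · simp [hsa, hsb]

theorem Matrix.det_submatrix_eq_zero {n R : Type*} [Fintype n] [DecidableEq n] [CommRing R]
    {M : Matrix n n R} (hM : M.det = 0) (e f : Equiv.Perm n) : (M.submatrix e f).det = 0 := by
  have h : M.submatrix e f = (M.submatrix e id).submatrix id f := rfl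
  rw [h, Matrix.det_permute', Matrix.det_permute, hM, mul_zero, mul_zero]

/-- The permutation of `Fin 3` with three given values. -/
noncomputable def permOfNe {i j l : Fin 3} (hij : i ≠ j) (hil : i ≠ l) (hjl : j ≠ l) :
    Equiv.Perm (Fin 3) :=
  Equiv.ofBijective ![i, j, l] <| Finite.injective_iff_bijective.mp fun x y h => by
    fin_cases x <;> fin_cases y <;> simp_all [eq_comm]

/-- At a common zero of `F i` and `F j` on which the Jacobian vanishes, either the third
polynomial vanishes too or the curves `F i = 0` and `F j = 0` are tangent. -/
theorem eq_zero_or_minor_eq_zero_of_jac_eq_zero (hd : ∀ i, 0 < d i)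
    {F : Fin 3 → MvPolynomial (Fin 3) ℂ} (hF : ∀ i, (F i).IsHomogeneous (d i))
    {p : Fin 3 → ℂ} (hJ : eval p (jac F) = 0) {i j l k a b : Fin 3}
    (hij : i ≠ j) (hil : i ≠ l) (hjl : j ≠ l) (hka : a ≠ k) (hkb : b ≠ k) (hab : a ≠ b)
    (hi : eval p (F i) = 0) (hj : eval p (F j) = 0) :
    eval p (F l) = 0 ∨ eval p (pderiv a (F i)) * eval p (pderiv b (F j)) =
      eval p (pderiv b (F i)) * eval p (pderiv a (F j)) := by
  have euler (i : Fin 3) : p k * eval p (pderiv k (F i)) + p a * eval p (pderiv a (F i)) +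
      p b * eval p (pderiv b (F i)) = d i * eval p (F i) := by
    have h := congrArg (eval p) (hF i).sum_X_mul_pderiv
    rw [← Equiv.sum_comp (permOfNe hka.symm hkb.symm hab), Fin.sum_univ_three] at h
    simpa [permOfNe] using h
  have ei := euler i
  have ej := euler j
  have el := euler l
  rw [hi] at ei
  rw [hj] at ej
  rw [jac, RingHom.map_det] at hJ
  have hdet := Matrix.det_submatrix_eq_zero hJ (permOfNe hij hil hjl)
    (permOfNe hka.symm hkb.symm hab)
  rw [Matrix.det_fin_three] at hdet
  simp only [permOfNe, jacMat, Matrix.submatrix_apply, Equiv.ofBijective_apply,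
    RingHom.mapMatrix_apply, Matrix.map_apply, Matrix.of_apply, Matrix.cons_val] at hdet
  have hl : (d l : ℂ) ≠ 0 := Nat.cast_ne_zero.mpr (hd l).ne'
  suffices h : d l * (eval p (F l) * (eval p (pderiv a (F i)) * eval p (pderiv b (F j)) -
      eval p (pderiv b (F i)) * eval p (pderiv a (F j)))) = 0 by
    simpa [hl, sub_eq_zero] using h
  linear_combination p k * hdet -
    (eval p (pderiv a (F i)) * eval p (pderiv b (F j)) -
      eval p (pderiv b (F i)) * eval p (pderiv a (F j))) * el +
    (eval p (pderiv a (F i)) * eval p (pderiv b (F l)) -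
      eval p (pderiv b (F i)) * eval p (pderiv a (F l))) * ej -
    (eval p (pderiv a (F j)) * eval p (pderiv b (F l)) -
      eval p (pderiv b (F j)) * eval p (pderiv a (F l))) * ei

theorem eq_one_of_pow_eq_one_of_coprime {M : Type*} [Monoid M] {c : M} {m n : ℕ}
    (h : Nat.gcd m n = 1) (hm : c ^ m = 1) (hn : c ^ n = 1) : c = 1 := by
  simpa [h] using (pow_gcd_eq_one (m := m) (n := n)).mpr ⟨hm, hn⟩

theorem exists_eq_zero_of_pow_mul_eq {c : ℂ} (hc : c ≠ 1) (hcop : ∀ i j, i ≠ j → (d i).gcd (d j) = 1)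
    {y : Fin 3 → ℂ} (hy : ∀ i, c ^ d i * y i = y i) : ∃ i j, i ≠ j ∧ y i = 0 ∧ y j = 0 := by
  have h (i j : Fin 3) (hij : i ≠ j) : y i = 0 ∨ y j = 0 := by
    by_contra! h
    exact hc <| eq_one_of_pow_eq_one_of_coprime (hcop i j hij)
      ((mul_eq_right₀ h.1).mp (hy i)) ((mul_eq_right₀ h.2).mp (hy j))
  have h01 := h 0 1 (by decide)
  have h02 := h 0 2 (by decide)
  have h12 := h 1 2 (by decide)
  by_cases h0 : y 0 = 0
  · rcases h12 with h1 | h2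
    · exact ⟨0, 1, by decide, h0, h1⟩
    · exact ⟨0, 2, by decide, h0, h2⟩
  · exact ⟨1, 2, by decide, h01.resolve_left h0, h02.resolve_left h0⟩

theorem exists_eq_mul_or_exists_eq_mul {K : Type*} [Field K] {a b c e : K} (h : a * e = b * c) :
    (∃ t, c = t * a ∧ e = t * b) ∨ ∃ t, a = t * c ∧ b = t * e := by
  by_cases ha : a = 0
  · by_cases hb : b = 0
    · exact .inr ⟨0, by simp [ha], by simp [hb]⟩
    · refine .inl ⟨e / b, ?_, by field_simp⟩
      have : c = 0 := by simpa [ha, hb] using h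
      simp [this, ha]
  · refine .inl ⟨c / a, by field_simp, ?_⟩
    field_simp
    linear_combination h

/-- For pairwise coprime degrees `d₁,d₂,d₃` and generic `F ∈ H(d₁,d₂,d₃)`, the map `F`
restricted to any ray contained in its critical set is injective: for nonzero critical `p`
and `λ ∈ ℂ`, `F(λp) = F(p)` implies `λ = 1`. -/
theorem generic_injective_on_rays_in_crit_of_pairwise_coprime
    (d : Fin 3 → ℕ) (hd : ∀ i, 0 < d i)
    (hcop : ∀ i j : Fin 3, i ≠ j → Nat.gcd (d i) (d j) = 1) :
    ∃ R : MvPolynomial (CoeffIdx d) ℂ, R ≠ 0 ∧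
      ∀ F : Fin 3 → MvPolynomial (Fin 3) ℂ,
        (∀ i, (F i).IsHomogeneous (d i)) →
        MvPolynomial.eval (coeffsOf d F) R ≠ 0 →
        ∀ p : Fin 3 → ℂ, p ≠ 0 → MvPolynomial.eval p (jac F) = 0 →
          ∀ lam : ℂ,
            (∀ i, MvPolynomial.eval (lam • p) (F i) = MvPolynomial.eval p (F i)) →
            lam = 1 := by
    classical
  have hT (x : Fin 3 × Fin 3 × Fin 3) : ∃ R : MvPolynomial (CoeffIdx d) ℂ, R ≠ 0 ∧
      (x.2.1 ≠ x.2.2 → ∀ F : Fin 3 → MvPolynomial (Fin 3) ℂ, (∀ i, (F i).IsHomogeneous (d i)) →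
        ∀ q : Fin 3 → ℂ, q x.1 = 1 → eval q (F x.2.1) = 0 → eval q (F x.2.2) = 0 → ∀ t : ℂ,
          eval q (pderiv (x.1 + 1) (F x.2.2)) = t * eval q (pderiv (x.1 + 1) (F x.2.1)) →
          eval q (pderiv (x.1 + 2) (F x.2.2)) = t * eval q (pderiv (x.1 + 2) (F x.2.1)) →
          eval (coeffsOf d F) R = 0) := by
    by_cases hx : x.2.1 = x.2.2
    · exact ⟨1, one_ne_zero, fun h => absurd hx h⟩
    · obtain ⟨R, hR, h⟩ := exists_ne_zero_of_tangent hd (k := x.1) (a := x.1 + 1) (b := x.1 + 2)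
        (by simp) (by simp) (by simp) hx
      exact ⟨R, hR, fun _ => h⟩
  choose T hT0 hT using hT
  choose Z hZ0 hZ using exists_ne_zero_of_common_zero hd
  refine ⟨(∏ k, Z k) * ∏ x, T x, mul_ne_zero (Finset.prod_ne_zero_iff.mpr fun k _ => hZ0 k)
    (Finset.prod_ne_zero_iff.mpr fun x _ => hT0 x), fun F hF hR p hp hJ lam hlam => ?_⟩
  simp only [map_mul, map_prod, mul_ne_zero_iff, Finset.prod_ne_zero_iff, Finset.mem_univ,
    true_imp_iff] at hR
  obtain ⟨hRZ, hRT⟩ := hR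
  by_contra hne
  obtain ⟨i, j, hij, hi, hj⟩ := exists_eq_zero_of_pow_mul_eq hne hcop
    (y := fun i => eval p (F i)) fun i => ((hF i).eval_smul lam p).symm.trans (hlam i)
  obtain ⟨l, hil, hjl⟩ : ∃ l, i ≠ l ∧ j ≠ l :=
    (by decide : ∀ i j : Fin 3, i ≠ j → ∃ l, i ≠ l ∧ j ≠ l) i j hij
  obtain ⟨k, hk⟩ := Function.ne_iff.mp hp
  have hk' : ((p k)⁻¹ • p) k = 1 := inv_mul_cancel₀ hk
  have hqi (i : Fin 3) (hi : eval p (F i) = 0) : eval ((p k)⁻¹ • p) (F i) = 0 := by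
    rw [(hF i).eval_smul, hi, mul_zero]
  rcases eq_zero_or_minor_eq_zero_of_jac_eq_zero hd hF hJ hij hil hjl (k := k) (a := k + 1)
    (b := k + 2) (by simp) (by simp) (by simp) hi hj with hl | hminor
  · refine hRZ k (hZ k F hF _ hk' fun m => hqi m ?_)
    have : m = i ∨ m = j ∨ m = l := by lia
    rcases this with rfl | rfl | rfl <;> assumption
  · have hminor' : eval ((p k)⁻¹ • p) (pderiv (k + 1) (F i)) *
        eval ((p k)⁻¹ • p) (pderiv (k + 2) (F j)) =
        eval ((p k)⁻¹ • p) (pderiv (k + 2) (F i)) *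
        eval ((p k)⁻¹ • p) (pderiv (k + 1) (F j)) := by
      simp only [(hF _).pderiv.eval_smul]
      linear_combination (p k)⁻¹ ^ (d i - 1) * (p k)⁻¹ ^ (d j - 1) * hminor
    rcases exists_eq_mul_or_exists_eq_mul hminor' with ⟨t, h1, h2⟩ | ⟨t, h1, h2⟩
    · exact hRT (k, i, j) (hT (k, i, j) hij F hF _ hk' (hqi i hi) (hqi j hj) t h1 h2)
    · exact hRT (k, j, i) (hT (k, j, i) hij.symm F hF _ hk' (hqi j hj) (hqi i hi) t h1 h2)
end

section
/- Let d1, d2 be even positive integers and d3 an odd positive integer with gcd(d1, d2) = 2 and gcd(d1, d3) = gcd(d2, d3) = 1. Then: (a) for every F = (f1, f2, f3) ∈ H(d1, d2, d3) and every p ∈ ℂ³ with f3(p) = 0 one has F(−p) = F(p); and (b) for generic F ∈ H(d1, d2, d3), for every p ∈ ℂ³ with p ≠ 0, J(F)(p) = 0 and f3(p) ≠ 0, and every λ ∈ ℂ, F(λp) = F(p) implies λ = 1; that is, F restricted to any ray contained in C(F) ∖ V(f3) is injective, while F restricted to any ray contained in C(F) ∩ V(f3) is 2:1. -/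
open MvPolynomial

namespace RayBehaviour

noncomputable section

instance (d : Fin 3 → ℕ) (i : Fin 3) :
    Finite { m : Fin 3 →₀ ℕ // (m.sum fun _ e => e) = d i } :=
  Set.Finite.to_subtype <| (Finset.finite_toSet (Finset.finsuppAntidiag Finset.univ (d i))).subset
    fun m hm => by simpa using Finset.mem_finsuppAntidiag'.2 ⟨hm, Finset.subset_univ _⟩

instance (d : Fin 3 → ℕ) : Finite (CoeffIdx d) :=
  inferInstanceAs (Finite (Σ i : Fin 3, { m : Fin 3 →₀ ℕ // (m.sum fun _ e => e) = d i }))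

instance (d : Fin 3 → ℕ) (i : Fin 3) :
    Fintype { m : Fin 3 →₀ ℕ // (m.sum fun _ e => e) = d i } :=
  Fintype.ofFinite _

/-- A polynomial map whose source has fewer coordinates than its target has image contained in a
hypersurface. -/
theorem exists_ne_zero_forall_eval_eq_zero {K σ τ : Type} [Field K] [Finite σ] [Finite τ]
    (h : Nat.card τ < Nat.card σ) (P : σ → MvPolynomial τ K) :
    ∃ R : MvPolynomial σ K, R ≠ 0 ∧ ∀ t : τ → K, eval (fun x => eval t (P x)) R = 0 := by
  have hP : ¬ AlgebraicIndependent K P := fun hP => by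
    have h1 := hP.cardinalMk_le_trdeg
    rw [MvPolynomial.trdeg_of_isDomain, Cardinal.lift_id, ← Nat.cast_card, ← Nat.cast_card,
      Nat.cast_le] at h1
    omega
  rw [algebraicIndependent_iff] at hP
  push Not at hP
  obtain ⟨R, hR, hR0⟩ := hP
  refine ⟨R, hR0, fun t => ?_⟩
  have h2 := congrArg (eval t) hR
  rw [map_zero, aeval_def, eval₂_eq_eval_map, ← eval₂_eq_eval_map, hom_eval₂] at h2
  convert h2 using 1
  rw [← eval₂_id]
  congr 1
  ext
  simp [algebraMap_eq]

section Generic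

variable {d : Fin 3 → ℕ} {A B : Type*} [CommRing A] [CommRing B]

/-- The index of the coefficient of the monomial `m` in the `i`-th polynomial. -/
def idx (i : Fin 3) (m : { m : Fin 3 →₀ ℕ // (m.sum fun _ e => e) = d i }) : CoeffIdx d :=
  ⟨i, m⟩

/-- The `i`-th member of the triple of homogeneous polynomials with coefficient tuple `c`. -/
def poly (c : CoeffIdx d → A) (i : Fin 3) : MvPolynomial (Fin 3) A :=
  ∑ m : { m : Fin 3 →₀ ℕ // (m.sum fun _ e => e) = d i }, monomial m.1 (c (idx i m))

theorem map_poly (h : A →+* B) (c : CoeffIdx d → A) (i : Fin 3) :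
    map h (poly c i) = poly (h ∘ c) i := by
  simp [poly, map_monomial, Function.comp_apply]

theorem eval_poly_comp (h : A →+* B) (c : CoeffIdx d → A) (p : Fin 3 → A) (i : Fin 3) :
    eval (h ∘ p) (poly (h ∘ c) i) = h (eval p (poly c i)) := by
  rw [← map_poly, eval_map, ← eval₂_id (g := p), hom_eval₂, RingHom.comp_id]
  rfl

theorem eval_pderiv_poly_comp (h : A →+* B) (c : CoeffIdx d → A) (p : Fin 3 → A) (i l : Fin 3) :
    eval (h ∘ p) (pderiv l (poly (h ∘ c) i)) = h (eval p (pderiv l (poly c i))) := by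
  rw [← map_poly, pderiv_map, eval_map, ← eval₂_id (g := p), hom_eval₂, RingHom.comp_id]
  rfl

theorem poly_add (c c' : CoeffIdx d → A) (i : Fin 3) :
    poly (fun x => c x + c' x) i = poly c i + poly c' i := by
  simp [poly, Finset.sum_add_distrib]

theorem poly_sum {ι : Type*} (s : Finset ι) (c : ι → CoeffIdx d → A) (i : Fin 3) :
    poly (fun x => ∑ r ∈ s, c r x) i = ∑ r ∈ s, poly (c r) i := by
  simp only [poly, map_sum]
  exact Finset.sum_comm

theorem idx_injective (i : Fin 3) : Function.Injective (idx (d := d) i) :=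
  fun _ _ h => eq_of_heq (Sigma.mk.inj h).2

theorem idx_ne {i j : Fin 3} (h : i ≠ j) (m : { m : Fin 3 →₀ ℕ // (m.sum fun _ e => e) = d i })
    (n : { m : Fin 3 →₀ ℕ // (m.sum fun _ e => e) = d j }) : idx i m ≠ idx j n :=
  fun h' => h (Sigma.mk.inj h').1

open Classical in
theorem poly_ite_self {i : Fin 3} (m : { m : Fin 3 →₀ ℕ // (m.sum fun _ e => e) = d i }) (a : A) :
    poly (fun x => if x = idx i m then a else 0) i = monomial m.1 a := by
  simp [poly, (idx_injective i).eq_iff, apply_ite]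

open Classical in
theorem poly_ite_of_ne {i j : Fin 3} (h : i ≠ j)
    (m : { m : Fin 3 →₀ ℕ // (m.sum fun _ e => e) = d i }) (a : A) :
    poly (fun x => if x = idx i m then a else 0) j = 0 := by
  simp [poly, idx_ne h.symm]

/-- The exponent of the monomial `x_k ^ (d i - 1) * x_r`, which has degree `d i`. -/
def nearPowExp (hd : ∀ i, 0 < d i) (i k r : Fin 3) :
    { m : Fin 3 →₀ ℕ // (m.sum fun _ e => e) = d i } :=
  ⟨Finsupp.single k (d i - 1) + Finsupp.single r 1, by
    have := hd i
    rw [Finsupp.sum_add_index' (by simp) (by simp), Finsupp.sum_single_index rfl,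
      Finsupp.sum_single_index rfl]
    omega⟩

/-- The index of the coefficient of `x_k ^ (d i - 1) * x_r` in the `i`-th polynomial. -/
abbrev nearPow (hd : ∀ i, 0 < d i) (i k r : Fin 3) : CoeffIdx d :=
  idx i (nearPowExp hd i k r)

theorem nearPow_injective (hd : ∀ i, 0 < d i) (i k : Fin 3) :
    Function.Injective (nearPow hd i k) := by
  intro r r' h
  have h1 := congrArg Subtype.val (idx_injective i h)
  exact Finsupp.single_left_injective one_ne_zero (add_left_cancel h1)

theorem nearPow_ne {hd : ∀ i, 0 < d i} {i j : Fin 3} (hij : i ≠ j) (k r k' r' : Fin 3) :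
    nearPow hd i k r ≠ nearPow hd j k' r' :=
  idx_ne hij _ _

theorem monomial_nearPowExp (hd : ∀ i, 0 < d i) (i k r : Fin 3) (a : A) :
    monomial (nearPowExp hd i k r).1 a = C a * X k ^ (d i - 1) * X r := by
  rw [nearPowExp, ← mul_one a, ← monomial_mul, C_mul_X_pow_eq_monomial, X]
  simp

theorem eval_monomial_nearPowExp (hd : ∀ i, 0 < d i) (i k r : Fin 3) (a : A) {p : Fin 3 → A}
    (hp : p k = 1) : eval p (monomial (nearPowExp hd i k r).1 a) = a * p r := by
  simp [monomial_nearPowExp, hp]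

theorem eval_pderiv_monomial_nearPowExp (hd : ∀ i, 0 < d i) (i : Fin 3) {k l : Fin 3} (hl : l ≠ k)
    (r : Fin 3) (a : A) {p : Fin 3 → A} (hp : p k = 1) :
    eval p (pderiv l (monomial (nearPowExp hd i k r).1 a)) = if r = l then a else 0 := by
  rw [monomial_nearPowExp, pderiv_mul, pderiv_C_mul, pderiv_pow, pderiv_X_of_ne hl.symm, pderiv_X]
  by_cases h : r = l <;> simp [hp, h]

variable (hd : ∀ i, 0 < d i) (k i j : Fin 3) (t : CoeffIdx d → A)

/-- The point encoded in the parameter tuple `t`, normalised to have `k`-th coordinate `1`. -/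
def point (r : Fin 3) : A := if r = k then 1 else t (nearPow hd i k r)

open Classical in
/-- The tuple `t` with the four coefficients which get solved for replaced by zero. -/
def base (x : CoeffIdx d) : A :=
  if (∃ r, x = nearPow hd i k r) ∨ x = nearPow hd j k k then 0 else t x

/-- The coefficient of `x_k ^ (d i - 1) * x_r`, `r ≠ k`, in the `i`-th polynomial forced by
proportionality of gradients. -/
def slope (r : Fin 3) : A :=
  t (nearPow hd j k k) * eval (point hd k i t) (pderiv r (poly (base hd k i j t) j)) -
    eval (point hd k i t) (pderiv r (poly (base hd k i j t) i))

/-- The coefficient of `x_k ^ (d i - 1) * x_r` in the `i`-th polynomial. -/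
def solved (r : Fin 3) : A :=
  if r = k then
    -(eval (point hd k i t) (poly (base hd k i j t) i) +
      ∑ l, if l = k then 0 else slope hd k i j t l * point hd k i t l)
  else slope hd k i j t r

open Classical in
/-- A polynomial parametrisation of the triples of polynomials for which the `i`-th and `j`-th
vanish at a point with `k`-th coordinate `1` and have proportional gradients there. -/
def tangentParam (x : CoeffIdx d) : A :=
  base hd k i j t x +
    (if x = nearPow hd j k k then -eval (point hd k i t) (poly (base hd k i j t) j) else 0) +
    ∑ r, if x = nearPow hd i k r then solved hd k i j t r else 0

theorem point_comp (h : A →+* B) : point hd k i (h ∘ t) = h ∘ point hd k i t := by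
  ext r
  simp [point, apply_ite h]

theorem base_comp (h : A →+* B) : base hd k i j (h ∘ t) = h ∘ base hd k i j t := by
  ext x
  simp [base, apply_ite h]

theorem slope_comp (h : A →+* B) (r : Fin 3) :
    slope hd k i j (h ∘ t) r = h (slope hd k i j t r) := by
  simp only [slope, point_comp, base_comp, eval_pderiv_poly_comp, map_sub, map_mul,
    Function.comp_apply]

theorem solved_comp (h : A →+* B) (r : Fin 3) :
    solved hd k i j (h ∘ t) r = h (solved hd k i j t r) := by
  simp only [solved, point_comp, base_comp, slope_comp, eval_poly_comp, apply_ite h, map_neg,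
    map_add, map_sum, map_mul, map_zero, Function.comp_apply]

theorem tangentParam_comp (h : A →+* B) (x : CoeffIdx d) :
    tangentParam hd k i j (h ∘ t) x = h (tangentParam hd k i j t x) := by
  simp only [tangentParam, point_comp, base_comp, solved_comp, eval_poly_comp, apply_ite h,
    map_neg, map_add, map_sum, map_zero, Function.comp_apply]

open Classical in
theorem eq_base_add {i j : Fin 3} (hij : i ≠ j) (c : CoeffIdx d → A) (x : CoeffIdx d) :
    c x = base hd k i j c x + (if x = nearPow hd j k k then c (nearPow hd j k k) else 0) +
      ∑ r, if x = nearPow hd i k r then c (nearPow hd i k r) else 0 := by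
  by_cases h1 : ∃ r, x = nearPow hd i k r
  · obtain ⟨r, rfl⟩ := h1
    simp [base, nearPow_ne hij, (nearPow_injective hd i k).eq_iff]
  · have h2 : ∀ r, x ≠ nearPow hd i k r := fun r hr => h1 ⟨r, hr⟩
    by_cases h3 : x = nearPow hd j k k
    · simp [base, h3, (nearPow_ne hij _ _ _ _).symm]
    · simp [base, h2, h3]

theorem poly_left_eq {i j : Fin 3} (hij : i ≠ j) (c : CoeffIdx d → A) :
    poly c i = poly (base hd k i j c) i +
      ∑ r, monomial (nearPowExp hd i k r).1 (c (nearPow hd i k r)) := by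
  classical
  conv_lhs => rw [funext (eq_base_add hd k hij c)]
  rw [poly_add, poly_add, poly_sum, poly_ite_of_ne hij.symm, add_zero]
  congr 1
  exact Finset.sum_congr rfl fun r _ => poly_ite_self _ _

theorem poly_right_eq {i j : Fin 3} (hij : i ≠ j) (c : CoeffIdx d → A) :
    poly c j = poly (base hd k i j c) j +
      monomial (nearPowExp hd j k k).1 (c (nearPow hd j k k)) := by
  classical
  conv_lhs => rw [funext (eq_base_add hd k hij c)]
  rw [poly_add, poly_add, poly_sum, Finset.sum_eq_zero fun r _ => poly_ite_of_ne hij _ _,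
    add_zero]
  congr 1
  exact poly_ite_self _ _

theorem tangentParam_eq {k i j : Fin 3} (hij : i ≠ j) {t c : CoeffIdx d → A} {q : Fin 3 → A}
    (hq : q k = 1) (htq : ∀ r, r ≠ k → t (nearPow hd i k r) = q r)
    (ht : ∀ x, (∀ r, x ≠ nearPow hd i k r) → x ≠ nearPow hd j k k → t x = c x)
    (hi : eval q (poly c i) = 0) (hj : eval q (poly c j) = 0)
    (hs : ∀ l, eval q (pderiv l (poly c i)) =
      t (nearPow hd j k k) * eval q (pderiv l (poly c j))) :
    tangentParam hd k i j t = c := by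
  have hp : point hd k i t = q := by
    ext r
    by_cases h : r = k
    · simp [point, h, hq]
    · simp [point, h, htq r h]
  have hb : base hd k i j t = base hd k i j c := by
    ext x
    unfold base
    split_ifs with h
    · rfl
    · push Not at h
      exact ht x h.1 h.2
  have hcj : c (nearPow hd j k k) = -eval q (poly (base hd k i j c) j) := by
    rw [poly_right_eq hd k hij, map_add, eval_monomial_nearPowExp hd _ _ _ _ hq, hq] at hj
    linear_combination hj
  have hsl : ∀ r, r ≠ k → slope hd k i j t r = c (nearPow hd i k r) := by
    intro r hr
    have h := hs r
    rw [poly_left_eq hd k hij, poly_right_eq hd k hij, map_add, map_add, map_add, map_add,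
      map_sum, map_sum, eval_pderiv_monomial_nearPowExp hd _ hr _ _ hq, if_neg hr.symm] at h
    simp only [eval_pderiv_monomial_nearPowExp hd _ hr _ _ hq, Finset.sum_ite_eq',
      Finset.mem_univ, if_true] at h
    rw [slope, hp, hb]
    linear_combination -h
  have hso : ∀ r, solved hd k i j t r = c (nearPow hd i k r) := by
    intro r
    unfold solved
    split_ifs with h
    · subst h
      rw [poly_left_eq hd r hij, map_add, map_sum] at hi
      simp only [eval_monomial_nearPowExp hd _ _ _ _ hq] at hi
      have h1 : ∀ l, (if l = r then 0 else slope hd r i j t l * q l) =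
          c (nearPow hd i r l) * q l - if l = r then c (nearPow hd i r r) else 0 := by
        intro l
        split_ifs with hl
        · subst hl; simp [hq]
        · rw [hsl l hl, sub_zero]
      rw [hp, hb]
      simp only [h1, Finset.sum_sub_distrib, Finset.sum_ite_eq', Finset.mem_univ, if_true]
      linear_combination -hi
    · exact hsl r h
  ext x
  rw [eq_base_add hd k hij c x, tangentParam, hp, hb, hcj]
  simp only [hso]

end Generic

theorem poly_coeffsOf {d : Fin 3 → ℕ} {F : Fin 3 → MvPolynomial (Fin 3) ℂ} {i : Fin 3}
    (hF : (F i).IsHomogeneous (d i)) : poly (coeffsOf d F) i = F i := by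
  classical
  ext m
  simp only [poly, coeffsOf, idx, coeff_sum, coeff_monomial]
  by_cases hm : (m.sum fun _ e => e) = d i
  · rw [Finset.sum_eq_single ⟨m, hm⟩]
    · simp
    · intro b _ hb
      exact if_neg fun h => hb (Subtype.ext h)
    · simp
  · rw [hF.coeff_eq_zero hm]
    refine Finset.sum_eq_zero fun b _ => if_neg ?_
    rintro rfl
    exact hm b.2

/-- Triples whose `i`-th and `j`-th members are tangent at a common zero off `x_k = 0` lie in a
hypersurface of the coefficient space. -/
theorem exists_tangent_hypersurface {d : Fin 3 → ℕ} (hd : ∀ i, 0 < d i) (k : Fin 3) {i j : Fin 3}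
    (hij : i ≠ j) :
    ∃ R : MvPolynomial (CoeffIdx d) ℂ, R ≠ 0 ∧
      ∀ F : Fin 3 → MvPolynomial (Fin 3) ℂ, (∀ i, (F i).IsHomogeneous (d i)) →
        ∀ q : Fin 3 → ℂ, q k = 1 → eval q (F i) = 0 → eval q (F j) = 0 →
          ∀ s : ℂ, (∀ l, eval q (pderiv l (F i)) = s * eval q (pderiv l (F j))) →
            eval (coeffsOf d F) R = 0 := by
  classical
  let e := nearPow hd i k k
  let extend (A : Type) [CommRing A] (u : {x // x ≠ e} → A) (x : CoeffIdx d) : A :=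
    if h : x = e then 0 else u ⟨x, fun h' => h h'⟩
  have hcard : Nat.card {x // x ≠ e} < Nat.card (CoeffIdx d) :=
    Finite.card_subtype_lt (x := e) (by simp)
  obtain ⟨R, hR, h⟩ := exists_ne_zero_forall_eval_eq_zero hcard
    (tangentParam hd k i j (extend (MvPolynomial {x // x ≠ e} ℂ) X))
  refine ⟨R, hR, fun F hF q hq hi hj s hs => ?_⟩
  let t (x : CoeffIdx d) : ℂ :=
    if x = nearPow hd j k k then s else
      if hx : ∃ r, x = nearPow hd i k r then q hx.choose else coeffsOf d F x
  have hext : (eval fun x : {x // x ≠ e} => t x) ∘ extend (MvPolynomial {x // x ≠ e} ℂ) X =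
      extend ℂ fun x => t x := by
    ext x
    by_cases hx : x = e <;> simp [extend, hx]
  have h1 := h fun x => t x
  simp only [← tangentParam_comp, hext] at h1
  rw [tangentParam_eq hd hij (c := coeffsOf d F) hq] at h1
  · exact h1
  · intro r hr
    have hx : ∃ r', nearPow hd i k r = nearPow hd i k r' := ⟨r, rfl⟩
    have h2 : hx.choose = r := (nearPow_injective hd i k hx.choose_spec).symm
    simp [extend, e, t, (nearPow_injective hd i k).eq_iff, hr, nearPow_ne hij]
  · intro x hx hxj
    simp [extend, e, t, hx, hxj]
  · rwa [poly_coeffsOf (hF i)]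
  · rwa [poly_coeffsOf (hF j)]
  · rw [poly_coeffsOf (hF i), poly_coeffsOf (hF j)]
    simpa [extend, e, t, nearPow_ne hij.symm] using hs

theorem eval_smul_of_isHomogeneous {σ K : Type*} [CommSemiring K] {f : MvPolynomial σ K} {n : ℕ}
    (hf : f.IsHomogeneous n) (a : K) (p : σ → K) : eval (a • p) f = a ^ n * eval p f := by
  rw [eval_eq, eval_eq, Finset.mul_sum]
  refine Finset.sum_congr rfl fun m hm => ?_
  have h : m.degree = n := by
    by_contra h
    exact (mem_support_iff.1 hm) (hf.coeff_eq_zero h)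
  simp only [Pi.smul_apply, smul_eq_mul, mul_pow, Finset.prod_mul_distrib]
  rw [Finset.prod_pow_eq_pow_sum, ← h, Finsupp.degree_apply]
  ring

/-- At a critical point where the first two polynomials vanish and the third does not, the
gradients of the first two are proportional. -/
theorem exists_gradient_proportional {d : Fin 3 → ℕ} (hd : ∀ i, 0 < d i)
    {F : Fin 3 → MvPolynomial (Fin 3) ℂ} (hF : ∀ i, (F i).IsHomogeneous (d i)) {p : Fin 3 → ℂ}
    (hJ : eval p (jac F) = 0) (h0 : eval p (F 0) = 0) (h1 : eval p (F 1) = 0)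
    (h2 : eval p (F 2) ≠ 0) :
    ∃ s : ℂ, (∀ l, eval p (pderiv l (F 0)) = s * eval p (pderiv l (F 1))) ∨
      ∀ l, eval p (pderiv l (F 1)) = s * eval p (pderiv l (F 0)) := by
  have hE : ∀ i, ∑ l, p l * eval p (pderiv l (F i)) = d i * eval p (F i) := by
    intro i
    simpa using congrArg (eval p) (hF i).sum_X_mul_pderiv
  have hdet : ((eval p).mapMatrix (jacMat F)).det = 0 := by
    rw [← RingHom.map_det]
    exact hJ
  obtain ⟨v, hv, hvM⟩ := Matrix.exists_vecMul_eq_zero_iff.2 hdet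
  have hM : ∀ l, v 0 * eval p (pderiv l (F 0)) + v 1 * eval p (pderiv l (F 1)) +
      v 2 * eval p (pderiv l (F 2)) = 0 := by
    intro l
    simpa [Matrix.vecMul, dotProduct, Fin.sum_univ_three, jacMat] using congrFun hvM l
  have hv2 : v 2 = 0 := by
    have e0 := hE 0
    have e1 := hE 1
    have e2 := hE 2
    rw [Fin.sum_univ_three] at e0 e1 e2
    have h3 : v 2 * (d 2 * eval p (F 2)) = 0 := by
      rw [h0] at e0
      rw [h1] at e1
      linear_combination p 0 * hM 0 + p 1 * hM 1 + p 2 * hM 2 - v 0 * e0 - v 1 * e1 - v 2 * e2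
    have h4 : (d 2 : ℂ) ≠ 0 := Nat.cast_ne_zero.2 (hd 2).ne'
    simpa [h4, h2] using h3
  by_cases hv0 : v 0 = 0
  · have hv1 : v 1 ≠ 0 := fun hv1 => hv (by ext l; fin_cases l <;> simp [*])
    refine ⟨0, Or.inr fun l => ?_⟩
    have := hM l
    simpa [hv0, hv2, hv1] using this
  · refine ⟨-(v 1 / v 0), Or.inl fun l => ?_⟩
    have := hM l
    rw [hv2] at this
    field_simp
    linear_combination this

/-- Generically, the first two polynomials have no common zero at a critical point off the zero
locus of the third. -/
theorem exists_transversality_hypersurface {d : Fin 3 → ℕ} (hd : ∀ i, 0 < d i) :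
    ∃ R : MvPolynomial (CoeffIdx d) ℂ, R ≠ 0 ∧
      ∀ F : Fin 3 → MvPolynomial (Fin 3) ℂ, (∀ i, (F i).IsHomogeneous (d i)) →
        eval (coeffsOf d F) R ≠ 0 → ∀ p : Fin 3 → ℂ, p ≠ 0 → eval p (jac F) = 0 →
          eval p (F 2) ≠ 0 → eval p (F 0) ≠ 0 ∨ eval p (F 1) ≠ 0 := by
  choose R hR h using fun k => exists_tangent_hypersurface hd k (i := 0) (j := 1) (by decide)
  choose R' hR' h' using fun k => exists_tangent_hypersurface hd k (i := 1) (j := 0) (by decide)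
  refine ⟨∏ k, R k * R' k, Finset.prod_ne_zero_iff.2 fun k _ => mul_ne_zero (hR k) (hR' k),
    fun F hF hev p hp hJ h2 => ?_⟩
  by_contra! hcon
  obtain ⟨h0, h1⟩ := hcon
  obtain ⟨k, hk⟩ := Function.ne_iff.1 hp
  have hk : p k ≠ 0 := hk
  have hq : ((p k)⁻¹ • p) k = 1 := by simp [hk]
  rw [map_prod, Finset.prod_ne_zero_iff] at hev
  have hne := hev k (Finset.mem_univ k)
  rw [map_mul] at hne
  have hz : ∀ i, eval p (F i) = 0 → eval ((p k)⁻¹ • p) (F i) = 0 := fun i hi => by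
    rw [eval_smul_of_isHomogeneous (hF i), hi, mul_zero]
  have hscale : ∀ {i j : Fin 3} {s : ℂ},
      (∀ l, eval p (pderiv l (F i)) = s * eval p (pderiv l (F j))) →
      ∀ l, eval ((p k)⁻¹ • p) (pderiv l (F i)) =
        (p k)⁻¹ ^ (d i - 1) * s * p k ^ (d j - 1) * eval ((p k)⁻¹ • p) (pderiv l (F j)) := by
    intro i j s hs l
    rw [eval_smul_of_isHomogeneous (hF i).pderiv, eval_smul_of_isHomogeneous (hF j).pderiv, hs l]
    have h3 : (p k)⁻¹ ^ (d j - 1) * p k ^ (d j - 1) = 1 := by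
      rw [← mul_pow, inv_mul_cancel₀ hk, one_pow]
    linear_combination
      -((p k)⁻¹ ^ (d i - 1) * s * eval p (pderiv l (F j))) * h3
  obtain ⟨s, hs | hs⟩ := exists_gradient_proportional hd hF hJ h0 h1 h2
  · exact left_ne_zero_of_mul hne (h k F hF _ hq (hz 0 h0) (hz 1 h1) _ (hscale hs))
  · exact right_ne_zero_of_mul hne (h' k F hF _ hq (hz 1 h1) (hz 0 h0) _ (hscale hs))

theorem eq_one_of_pow_eq_one_of_gcd {M : Type*} [Monoid M] {a : M} {m n : ℕ}
    (h : Nat.gcd m n = 1) (hm : a ^ m = 1) (hn : a ^ n = 1) : a = 1 := by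
  have h1 := Nat.dvd_gcd (orderOf_dvd_of_pow_eq_one hm) (orderOf_dvd_of_pow_eq_one hn)
  rw [h, Nat.dvd_one] at h1
  exact orderOf_eq_one_iff.1 h1

end

end RayBehaviour

/-- For `d₁, d₂` even, `d₃` odd with `gcd(d₁,d₂) = 2` and `gcd(d₁,d₃) = gcd(d₂,d₃) = 1`:
(a) every `F ∈ H(d₁,d₂,d₃)` satisfies `F(-p) = F(p)` whenever `f₃(p) = 0` (so `F` is `2:1`
on rays in `C(F) ∩ V(f₃)`), and (b) for generic `F`, on any ray contained in
`C(F) ∖ V(f₃)` the map `F` is injective: `F(λp) = F(p)` forces `λ = 1`. -/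
theorem ray_behaviour_of_crit_when_two_degrees_even
    (d : Fin 3 → ℕ) (hd : ∀ i, 0 < d i)
    (h1 : Even (d 0)) (h2 : Even (d 1)) (h3 : Odd (d 2))
    (hgcd12 : Nat.gcd (d 0) (d 1) = 2)
    (hgcd13 : Nat.gcd (d 0) (d 2) = 1) (hgcd23 : Nat.gcd (d 1) (d 2) = 1) :
    (∀ F : Fin 3 → MvPolynomial (Fin 3) ℂ,
      (∀ i, (F i).IsHomogeneous (d i)) →
      ∀ p : Fin 3 → ℂ, MvPolynomial.eval p (F 2) = 0 →
        ∀ i, MvPolynomial.eval (-p) (F i) = MvPolynomial.eval p (F i)) ∧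
    ∃ R : MvPolynomial (CoeffIdx d) ℂ, R ≠ 0 ∧
      ∀ F : Fin 3 → MvPolynomial (Fin 3) ℂ,
        (∀ i, (F i).IsHomogeneous (d i)) →
        MvPolynomial.eval (coeffsOf d F) R ≠ 0 →
        ∀ p : Fin 3 → ℂ, p ≠ 0 →
          MvPolynomial.eval p (jac F) = 0 → MvPolynomial.eval p (F 2) ≠ 0 →
          ∀ lam : ℂ,
            (∀ i, MvPolynomial.eval (lam • p) (F i) = MvPolynomial.eval p (F i)) →
            lam = 1 := by
  constructor
  · intro F hF p hp i
    have h := RayBehaviour.eval_smul_of_isHomogeneous (hF i) (-1) p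
    rw [neg_one_smul] at h
    rw [h]
    match i with
    | 0 => rw [h1.neg_one_pow, one_mul]
    | 1 => rw [h2.neg_one_pow, one_mul]
    | 2 => rw [hp, mul_zero]
  · obtain ⟨R, hR, h⟩ := RayBehaviour.exists_transversality_hypersurface hd
    refine ⟨R, hR, fun F hF hev p hp hJ hp2 lam hlam => ?_⟩
    have hpow : ∀ i, eval p (F i) ≠ 0 → lam ^ d i = 1 := fun i hi => by
      have h3 := hlam i
      rw [RayBehaviour.eval_smul_of_isHomogeneous (hF i)] at h3
      exact mul_right_cancel₀ hi (h3.trans (one_mul _).symm)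
    obtain h0 | h0 := h F hF hev p hp hJ hp2
    · exact RayBehaviour.eq_one_of_pow_eq_one_of_gcd hgcd13 (hpow 0 h0) (hpow 2 hp2)
    · exact RayBehaviour.eq_one_of_pow_eq_one_of_gcd hgcd23 (hpow 1 h0) (hpow 2 hp2)
end
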